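/- arXiv:1710.01797 — 2 statements merged into one kernel-verified Lean document; each statement's English description precedes it below -/
import Mathlib

section
/- For every fixed x ∈ ℝ, the normalized Black-Scholes call price has the large-volatility asymptotics lim_{v→∞} (e^{x/2} − c(x,v))·v / (4·φ(v/2)) = 1, where φ(z) = (1/√(2π))·e^{−z²/2} is the standard normal density. -/
open Real Set Filter

/-- The standard normal cumulative distribution function Φ. -/
noncomputable def stdNormalCDF (y : ℝ) : ℝ :=
  (Real.sqrt (2 * Real.pi))⁻¹ * ∫ t in Set.Iic y, Real.exp (-t ^ 2 / 2)

/-- The normalized Black-Scholes call price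
`c(x,v) = e^{x/2} Φ(x/v + v/2) − e^{−x/2} Φ(x/v − v/2)`. -/
noncomputable def normCall (x v : ℝ) : ℝ :=
  Real.exp (x / 2) * stdNormalCDF (x / v + v / 2) -
    Real.exp (-x / 2) * stdNormalCDF (x / v - v / 2)

/-- The standard normal density `φ(z) = (1/√(2π)) e^{−z²/2}`. -/
noncomputable def stdNormalPDF (z : ℝ) : ℝ :=
  (Real.sqrt (2 * Real.pi))⁻¹ * Real.exp (-z ^ 2 / 2)

theorem integrable_exp_neg_sq_div_two : MeasureTheory.Integrable fun t : ℝ => exp (-t ^ 2 / 2) := by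
  convert integrable_exp_neg_mul_sq (b := 1 / 2) (by norm_num) using 3
  ring

theorem integral_exp_neg_sq_div_two : ∫ t : ℝ, exp (-t ^ 2 / 2) = √(2 * π) := by
  convert integral_gaussian (1 / 2) using 2
  · ext t
    congr 1
    ring
  · ring_nf

theorem setIntegral_Iic_eq_add_intervalIntegral (y : ℝ) :
    ∫ t in Iic y, exp (-t ^ 2 / 2) =
      (∫ t in Iic (0 : ℝ), exp (-t ^ 2 / 2)) + ∫ t in (0 : ℝ)..y, exp (-t ^ 2 / 2) := by
  rw [← intervalIntegral.integral_Iic_sub_Iic integrable_exp_neg_sq_div_two.integrableOn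
    integrable_exp_neg_sq_div_two.integrableOn]
  ring

theorem hasDerivAt_setIntegral_Iic_exp (y : ℝ) :
    HasDerivAt (fun y => ∫ t in Iic y, exp (-t ^ 2 / 2)) (exp (-y ^ 2 / 2)) y := by
  rw [funext setIntegral_Iic_eq_add_intervalIntegral]
  have hc : Continuous fun t : ℝ => exp (-t ^ 2 / 2) := by fun_prop
  exact (hc.integral_hasStrictDerivAt 0 y).hasDerivAt.const_add _

theorem tendsto_setIntegral_Iic_exp_atBot :
    Tendsto (fun y : ℝ => ∫ t in Iic y, exp (-t ^ 2 / 2)) atBot (nhds 0) := by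
  have h := MeasureTheory.intervalIntegral_tendsto_integral_Iic (0 : ℝ)
    integrable_exp_neg_sq_div_two.integrableOn tendsto_id
  have h' := h.const_sub (∫ t in Iic (0 : ℝ), exp (-t ^ 2 / 2))
  rw [sub_self] at h'
  refine h'.congr fun y => ?_
  rw [setIntegral_Iic_eq_add_intervalIntegral y, intervalIntegral.integral_symm y 0, id]
  ring

/-- The left tail of the Gaussian integral is asymptotic to `e^{-y²/2} / (-y)`. -/
theorem tendsto_gaussian_left_tail_ratio :
    Tendsto (fun y : ℝ => (∫ t in Iic y, exp (-t ^ 2 / 2)) / (exp (-y ^ 2 / 2) * (-y)⁻¹))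
      atBot (nhds 1) := by
  have hinv : Tendsto (fun y : ℝ => (-y)⁻¹) atBot (nhds 0) :=
    tendsto_inv_atTop_zero.comp tendsto_neg_atBot_atTop
  refine HasDerivAt.lhopital_zero_atBot (f' := fun y => exp (-y ^ 2 / 2))
    (g' := fun y => exp (-y ^ 2 / 2) * (1 + (-y)⁻¹ ^ 2))
    (Eventually.of_forall hasDerivAt_setIntegral_Iic_exp) ?_ ?_
    tendsto_setIntegral_Iic_exp_atBot ?_ ?_
  · filter_upwards [eventually_lt_atBot 0] with y hy
    have hne : -y ≠ 0 := by linarith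
    have he := ((hasDerivAt_pow 2 y).neg.div_const 2).exp
    refine (he.mul ((hasDerivAt_neg y).inv hne)).congr_deriv ?_
    simp only [Pi.neg_apply, Pi.inv_apply]
    have : y ≠ 0 := hy.ne
    field_simp
    ring
  · exact Eventually.of_forall fun y => by positivity
  · refine squeeze_zero_norm' ?_ hinv
    filter_upwards [eventually_lt_atBot 0] with y hy
    have hpos : 0 < (-y)⁻¹ := inv_pos.mpr (by linarith)
    rw [norm_of_nonneg (by positivity)]
    exact mul_le_of_le_one_left hpos.le (exp_le_one_iff.mpr (by nlinarith [sq_nonneg y]))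
  · have h : Tendsto (fun y : ℝ => (1 + (-y)⁻¹ ^ 2)⁻¹) atBot (nhds 1) := by
      simpa using ((hinv.pow 2).const_add 1).inv₀ (by norm_num)
    refine h.congr fun y => ?_
    have : (1 + (-y)⁻¹ ^ 2) ≠ 0 := by positivity
    field_simp

theorem stdNormalCDF_neg (y : ℝ) : stdNormalCDF (-y) = 1 - stdNormalCDF y := by
  have hsymm : ∫ t in Iic (-y), exp (-t ^ 2 / 2) = ∫ t in Ioi y, exp (-t ^ 2 / 2) := by
    have h := integral_comp_neg_Iic (-y) fun t : ℝ => exp (-t ^ 2 / 2)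
    simp only [neg_sq, neg_neg] at h
    exact h
  have hadd := intervalIntegral.integral_Iic_add_Ioi (b := y)
    integrable_exp_neg_sq_div_two.integrableOn integrable_exp_neg_sq_div_two.integrableOn
  rw [integral_exp_neg_sq_div_two] at hadd
  have hne : √(2 * π) ≠ 0 := by positivity
  unfold stdNormalCDF
  rw [hsymm, eq_sub_of_add_eq' hadd]
  field_simp

theorem tendsto_exp_mul_stdNormalCDF_ratio (s : ℝ) :
    Tendsto (fun v => exp (s / 2) * stdNormalCDF (-(s / v + v / 2)) * v /
      (4 * stdNormalPDF (v / 2))) atTop (nhds (1 / 2)) := by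
  have hsv : Tendsto (fun v : ℝ => s / v) atTop (nhds 0) := tendsto_const_nhds.div_atTop tendsto_id
  have harg : Tendsto (fun v : ℝ => s / v + v / 2) atTop atTop :=
    hsv.add_atTop (tendsto_id.atTop_div_const two_pos)
  have hmills := tendsto_gaussian_left_tail_ratio.comp (tendsto_neg_atTop_atBot.comp harg)
  have hexp : Tendsto (fun v : ℝ => exp (-(s / v) ^ 2 / 2)) atTop (nhds 1) := by
    simpa using ((hsv.pow 2).neg.div_const 2).rexp
  have hfrac : Tendsto (fun v : ℝ => (4 * (s / v / v + 1 / 2))⁻¹) atTop (nhds (1 / 2)) := by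
    have h := ((hsv.div_atTop tendsto_id).add_const (1 / 2)).const_mul 4
    convert h.inv₀ (by norm_num) using 2 <;> norm_num
  have hprod := (hmills.mul hexp).mul hfrac
  rw [one_mul, one_mul] at hprod
  refine hprod.congr' ?_
  filter_upwards [eventually_gt_atTop 0, harg.eventually_gt_atTop 0] with v hv ha
  have hfactor : exp (-(-(s / v + v / 2)) ^ 2 / 2) =
      (exp (s / 2))⁻¹ * exp (-(s / v) ^ 2 / 2) * exp (-(v / 2) ^ 2 / 2) := by
    rw [← exp_neg, ← exp_add, ← exp_add]
    congr 1
    field_simp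
    ring
  have hden : s / v / v + 1 / 2 = (s / v + v / 2) / v := by field_simp
  have hne : √(2 * π) ≠ 0 := by positivity
  simp only [Function.comp_apply, stdNormalCDF, stdNormalPDF, hfactor, hden, neg_neg]
  generalize s / v + v / 2 = a at ha ⊢
  field_simp

/-- Large-volatility asymptotics of the normalized Black-Scholes call price:
`e^{x/2} − c(x,v) ≈ (4/v) φ(v/2)` as `v → ∞`. -/
theorem normCall_asymptotics_large_vol (x : ℝ) :
    Filter.Tendsto
      (fun v => (Real.exp (x / 2) - normCall x v) * v / (4 * stdNormalPDF (v / 2)))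
      Filter.atTop (nhds 1) := by
  have h := (tendsto_exp_mul_stdNormalCDF_ratio x).add (tendsto_exp_mul_stdNormalCDF_ratio (-x))
  rw [add_halves] at h
  refine h.congr fun v => ?_
  have harg : -(-x / v + v / 2) = x / v - v / 2 := by ring
  rw [harg, stdNormalCDF_neg, normCall]
  ring
end

section
/- Let x_min < x_max ≤ 0 and let φ_x : [x_min, x_max] → [−1,1] be the affine bijection φ_x(x) = 1 − 2(x_max − x)/(x_max − x_min). Let ψ : ℝ² → ℝ be a function that is real-analytic on an open set containing [−1,1]² and satisfies 0 < ψ(c̃, x̃) < e^{φ_x^{−1}(x̃)/2} for all (c̃, x̃) ∈ [−1,1]². Define ṽ(c̃, x̃) as the unique v > 0 with c(φ_x^{−1}(x̃), v) = ψ(c̃, x̃). Then there exist constants ρ₁ > 1, ρ₂ > 1 and V > 0 such that for all integers N₁, N₂ ≥ 1 the bivariate Chebyshev interpolant I^{N₁,N₂}(c̃,x̃) = Σ_{j=0}^{N₁−1} Σ_{k=0}^{N₂−1} a_{jk}·T_j(c̃)·T_k(x̃) of ṽ satisfies max_{(c̃,x̃) ∈ [−1,1]²} |ṽ(c̃,x̃)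 − I^{N₁,N₂}(c̃,x̃)| ≤ 4V·((ρ₁^{−2(N₁−1)} + ρ₂^{−2(N₂−1)}) / ((1 − ρ₁^{−2})(1 − ρ₂^{−2})))^{1/2}. -/
open Real Set Filter

/-- The Chebyshev polynomial `T_j(x) = cos(j arccos x)` on `[−1,1]`. -/
noncomputable def chebT (j : ℕ) (x : ℝ) : ℝ := Real.cos (j * Real.arccos x)

/-- The Chebyshev points `x_k = cos(kπ/N)`, `k = 0, …, N`. -/
noncomputable def chebPt (N k : ℕ) : ℝ := Real.cos (k * Real.pi / N)

/-- Weight halving the first and last summand in `Σ''`. -/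
noncomputable def chebWeight (N k : ℕ) : ℝ := if k = 0 ∨ k = N then 1 / 2 else 1

/-- The bivariate Chebyshev coefficients
`a_{jk} = (2^{𝟙(0<j<N₁)}/N₁)(2^{𝟙(0<k<N₂)}/N₂) Σ''_{k₁=0}^{N₁} Σ''_{k₂=0}^{N₂}
 f(x_{k₁}, x_{k₂}) T_j(x_{k₁}) T_k(x_{k₂})`. -/
noncomputable def chebCoeff (f : ℝ → ℝ → ℝ) (N₁ N₂ j k : ℕ) : ℝ :=
  ((2 : ℝ) ^ (if 0 < j ∧ j < N₁ then 1 else 0) / N₁) *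
    ((2 : ℝ) ^ (if 0 < k ∧ k < N₂ then 1 else 0) / N₂) *
    ∑ k₁ ∈ Finset.range (N₁ + 1), ∑ k₂ ∈ Finset.range (N₂ + 1),
      chebWeight N₁ k₁ * chebWeight N₂ k₂ * f (chebPt N₁ k₁) (chebPt N₂ k₂) *
        chebT j (chebPt N₁ k₁) * chebT k (chebPt N₂ k₂)

/-- The bivariate Chebyshev interpolant
`I^{N₁,N₂}(c̃,x̃) = Σ_{j=0}^{N₁−1} Σ_{k=0}^{N₂−1} a_{jk} T_j(c̃) T_k(x̃)`. -/
noncomputable def chebInterp (f : ℝ → ℝ → ℝ) (N₁ N₂ : ℕ) (c' x' : ℝ) : ℝ :=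
  ∑ j ∈ Finset.range N₁, ∑ k ∈ Finset.range N₂,
    chebCoeff f N₁ N₂ j k * chebT j c' * chebT k x'

lemma hasDerivAt_stdNormalCDF (y : ℝ) :
    HasDerivAt stdNormalCDF ((√(2 * π))⁻¹ * exp (-y ^ 2 / 2)) y := by
  have hint : MeasureTheory.Integrable (fun t : ℝ => exp (-t ^ 2 / 2)) := by
    convert! integrable_exp_neg_mul_sq (b := 1 / 2) (by norm_num) using 3
    ring
  have hcont : Continuous (fun t : ℝ => exp (-t ^ 2 / 2)) := by fun_prop
  have h := (intervalIntegral.integral_hasDerivAt_right (a := 0) (b := y)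
    (hcont.intervalIntegrable _ _) (hcont.stronglyMeasurableAtFilter _ _) hcont.continuousAt).const_add
    (∫ t in Set.Iic (0 : ℝ), exp (-t ^ 2 / 2))
  refine (h.const_mul (√(2 * π))⁻¹).congr_of_eventuallyEq (Eventually.of_forall fun z => ?_)
  simp only [stdNormalCDF]
  rw [← intervalIntegral.integral_Iic_sub_Iic hint.integrableOn hint.integrableOn]
  ring

lemma analyticAt_stdNormalCDF (y : ℝ) : AnalyticAt ℝ stdNormalCDF y := by
  obtain ⟨F, hF⟩ := Differentiable.isExactOn_univ
    (f := fun z : ℂ => ((√(2 * π))⁻¹ : ℝ) * Complex.exp (-z ^ 2 / 2)) (by fun_prop)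
  have hFd : Differentiable ℂ F := fun z => (hF z (mem_univ z)).differentiableAt
  have hre : ∀ x : ℝ, HasDerivAt (fun t : ℝ => (F t).re)
      ((√(2 * π))⁻¹ * exp (-x ^ 2 / 2)) x := fun x => by
    convert! (hF x (mem_univ _)).real_of_complex using 1
    rw [Complex.re_ofReal_mul]
    congr 1
    rw [← Complex.ofReal_re (exp _)]
    push_cast
    rfl
  have hdiff : ∀ x, HasDerivAt (fun t : ℝ => stdNormalCDF t - (F t).re) 0 x := fun x => by
    simpa using (hasDerivAt_stdNormalCDF x).fun_sub (hre x)
  have hconst : stdNormalCDF = fun t : ℝ => (F t).re + (stdNormalCDF 0 - (F (0 : ℝ)).re) := by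
    funext t
    have := is_const_of_deriv_eq_zero (fun x => (hdiff x).differentiableAt)
      (fun x => (hdiff x).deriv) t 0
    linarith
  rw [hconst]
  exact (hFd.analyticAt (y : ℂ)).re_ofReal.add analyticAt_const

lemma hasDerivAt_normCall (x : ℝ) {v : ℝ} (hv : 0 < v) :
    HasDerivAt (normCall x)
      (exp (x / 2) * ((√(2 * π))⁻¹ * exp (-(x / v + v / 2) ^ 2 / 2))) v := by
  have h1 : HasDerivAt (fun v : ℝ => x / v + v / 2) (-x / v ^ 2 + 1 / 2) v := by
    simpa using ((hasDerivAt_const v x).fun_div (hasDerivAt_id' v) hv.ne').fun_add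
      ((hasDerivAt_id' v).div_const 2)
  have h2 : HasDerivAt (fun v : ℝ => x / v - v / 2) (-x / v ^ 2 - 1 / 2) v := by
    simpa using ((hasDerivAt_const v x).fun_div (hasDerivAt_id' v) hv.ne').fun_sub
      ((hasDerivAt_id' v).div_const 2)
  have h := (((hasDerivAt_stdNormalCDF _).comp v h1).const_mul (exp (x / 2))).sub
    (((hasDerivAt_stdNormalCDF _).comp v h2).const_mul (exp (-x / 2)))
  have hexp : exp (-x / 2) * exp (-(x / v - v / 2) ^ 2 / 2) =
      exp (x / 2) * exp (-(x / v + v / 2) ^ 2 / 2) := by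
    rw [← exp_add, ← exp_add]
    congr 1
    field_simp
    ring
  refine h.congr_deriv ?_
  linear_combination (-(√(2 * π))⁻¹ * (-x / v ^ 2 - 1 / 2)) * hexp

lemma deriv_normCall_pos (x : ℝ) {v : ℝ} (hv : 0 < v) : 0 < deriv (normCall x) v := by
  rw [(hasDerivAt_normCall x hv).deriv]
  positivity

lemma strictMonoOn_normCall (x : ℝ) : StrictMonoOn (normCall x) (Ioi 0) := by
  refine strictMonoOn_of_deriv_pos (convex_Ioi 0)
    (fun v hv => (hasDerivAt_normCall x hv).continuousAt.continuousWithinAt) fun v hv => ?_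
  rw [interior_Ioi] at hv
  exact deriv_normCall_pos x hv

lemma analyticAt_normCall {z : ℝ × ℝ} (hz : z.2 ≠ 0) :
    AnalyticAt ℝ (fun q : ℝ × ℝ => normCall q.1 q.2) z := by
  have hd : AnalyticAt ℝ (fun q : ℝ × ℝ => q.1 / q.2) z := analyticAt_fst.div analyticAt_snd hz
  have h2 : AnalyticAt ℝ (fun q : ℝ × ℝ => q.2 / 2) z := analyticAt_snd.div_const
  have h3 : AnalyticAt ℝ (fun q : ℝ × ℝ => q.1 / 2) z := analyticAt_fst.div_const
  have h4 : AnalyticAt ℝ (fun q : ℝ × ℝ => -q.1 / 2) z := analyticAt_fst.neg.div_const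
  unfold normCall
  exact (h3.rexp.mul ((analyticAt_stdNormalCDF _).fun_comp (hd.add h2))).sub
    (h4.rexp.mul ((analyticAt_stdNormalCDF _).fun_comp (hd.sub h2)))

/-- The implied volatility of analytic data is analytic: near each point of `S` it agrees on `S`
with an analytic function. -/
lemma exists_analyticAt_eq_of_normCall_eq {S : Set (ℝ × ℝ)} {X P v : ℝ × ℝ → ℝ} {p : ℝ × ℝ}
    (hp : p ∈ S) (hX : AnalyticAt ℝ X p) (hP : AnalyticAt ℝ P p)
    (hv : ∀ q ∈ S, 0 < v q ∧ normCall (X q) (v q) = P q) :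
    ∃ W : ℝ × ℝ → ℝ, AnalyticAt ℝ W p ∧ ∀ᶠ q in nhds p, q ∈ S → v q = W q := by
  set f : (ℝ × ℝ) × ℝ → ℝ := fun u => normCall (X u.1) u.2 - P u.1 with hf
  have hfa : AnalyticAt ℝ f (p, v p) := by
    refine AnalyticAt.sub ?_ (AnalyticAt.fun_comp (f := Prod.fst) (x := (p, v p)) hP analyticAt_fst)
    exact AnalyticAt.comp₂ (h := fun q : ℝ × ℝ => normCall q.1 q.2) (f := fun u => X u.1)
      (g := Prod.snd) (x := (p, v p)) (analyticAt_normCall (hv p hp).1.ne')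
      (AnalyticAt.fun_comp (f := Prod.fst) (x := (p, v p)) hX analyticAt_fst) analyticAt_snd
  have cdf : ContDiffAt ℝ ⊤ f (p, v p) := hfa.contDiffAt
  have hder : HasDerivAt (fun t => f (p, t))
      ((fderiv ℝ f (p, v p) ∘L .inr ℝ (ℝ × ℝ) ℝ) 1) (v p) := by
    have h := hfa.differentiableAt.hasFDerivAt.comp (v p)
      ((hasFDerivAt_const p (v p)).prodMk (hasFDerivAt_id (v p)))
    simpa [Function.comp_def] using h.hasDerivAt
  have hne : (fderiv ℝ f (p, v p) ∘L .inr ℝ (ℝ × ℝ) ℝ) 1 ≠ 0 := by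
    rw [← hder.deriv]
    have h : HasDerivAt (fun t => f (p, t)) (deriv (normCall (X p)) (v p)) (v p) :=
      (hasDerivAt_normCall (X p) (hv p hp).1).differentiableAt.hasDerivAt.sub_const (P p)
    rw [h.deriv]
    exact (deriv_normCall_pos _ (hv p hp).1).ne'
  have hinv : (fderiv ℝ f (p, v p) ∘L .inr ℝ (ℝ × ℝ) ℝ).IsInvertible := by
    refine ⟨ContinuousLinearEquiv.unitsEquivAut ℝ (Units.mk0 _ hne), ?_⟩
    ext
    simp
  refine ⟨cdf.implicitFunction (by simp) hinv,
    (cdf.contDiffAt_implicitFunction (by simp) hinv).analyticAt, ?_⟩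
  have hself := cdf.implicitFunction_apply_self (by simp) hinv
  have hcont : ContinuousAt (cdf.implicitFunction (by simp) hinv) p :=
    (cdf.contDiffAt_implicitFunction (by simp) hinv).continuousAt
  have hpos : ∀ᶠ q in nhds p, 0 < cdf.implicitFunction (by simp) hinv q := by
    refine hcont.eventually_const_lt ?_
    rw [hself]
    exact (hv p hp).1
  filter_upwards [hpos, cdf.eventually_apply_implicitFunction (by simp) hinv] with q hq hq' hqS
  refine (strictMonoOn_normCall (X q)).injOn (hv q hqS).1 hq ?_
  simp only [hf, (hv p hp).2, sub_self] at hq'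
  rw [(hv q hqS).2]
  linarith

/-- Local Cauchy estimates for the partial derivatives of an analytic function of two variables. -/
lemma AnalyticAt.eventually_abs_iteratedDeriv_slice_le {G : ℝ × ℝ → ℝ} {z₀ : ℝ × ℝ}
    (hG : AnalyticAt ℝ G z₀) (hG' : ContDiff ℝ ⊤ G) :
    ∃ C R : ℝ, 0 < C ∧ 0 < R ∧ ∀ᶠ z in nhds z₀, ∀ n : ℕ,
      |iteratedDeriv n (fun s => G (s, z.2)) z.1| ≤ C * n.factorial * R ^ n := by
  obtain ⟨p, r, hp⟩ := hG
  obtain ⟨r₀, hr₀, hr₀r⟩ := ENNReal.lt_iff_exists_nnreal_btwn.1 hp.r_pos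
  have hr₀' : 0 < r₀ := by exact_mod_cast hr₀
  set a : NNReal := r₀ / 2 with ha
  have ha0 : 0 < a := by positivity
  have haa : (a + a : ENNReal) < p.radius := by
    refine lt_of_eq_of_lt ?_ (hr₀r.trans_le hp.r_le)
    rw [← ENNReal.coe_add, ha, add_halves]
  have hsum := p.changeOriginSeries_summable_aux₁ haa
  set C : NNReal := ∑' s : Σ k l : ℕ, { s : Finset (Fin (k + l)) // s.card = l },
      ‖p (s.1 + s.2.1)‖₊ * a ^ s.2.1 * a ^ s.1 with hC
  refine ⟨C + 1, (a : ℝ)⁻¹, by positivity, by positivity, ?_⟩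
  filter_upwards [Metric.ball_mem_nhds z₀ (show (0 : ℝ) < a from ha0)] with z hz n
  set y := z - z₀ with hy
  have hya : ‖y‖₊ ≤ a := by
    rw [Metric.mem_ball, dist_eq_norm] at hz
    exact_mod_cast hz.le
  have hyr : (‖y‖₊ : ENNReal) < r := by
    refine lt_of_le_of_lt ?_ hr₀r
    rw [ENNReal.coe_le_coe]
    exact hya.trans (by rw [ha]; exact NNReal.half_le_self _)
  have hz' : z₀ + y = z := by simp [hy]
  have hq := hp.changeOrigin hyr
  rw [hz'] at hq
  have hcoef : ‖p.changeOrigin y n‖₊ * a ^ n ≤ C := by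
    have h1 := p.nnnorm_changeOrigin_le n (hyr.trans_le hp.r_le)
    have h2 := (NNReal.summable_sigma.1 hsum).2
    have h3 := (NNReal.summable_sigma.1 hsum).1 n
    calc ‖p.changeOrigin y n‖₊ * a ^ n
        ≤ (∑' s : Σ l : ℕ, { s : Finset (Fin (n + l)) // s.card = l },
            ‖p (n + s.1)‖₊ * ‖y‖₊ ^ s.1) * a ^ n := by gcongr
      _ = ∑' s : Σ l : ℕ, { s : Finset (Fin (n + l)) // s.card = l },
            ‖p (n + s.1)‖₊ * ‖y‖₊ ^ s.1 * a ^ n := by rw [NNReal.tsum_mul_right]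
      _ ≤ ∑' s : Σ l : ℕ, { s : Finset (Fin (n + l)) // s.card = l },
            ‖p (n + s.1)‖₊ * a ^ s.1 * a ^ n := by
          refine Summable.tsum_le_tsum (fun s => by gcongr) ?_ h3
          exact NNReal.summable_of_le (fun s => by gcongr) h3
      _ ≤ ∑' k, ∑' s : Σ l : ℕ, { s : Finset (Fin (k + l)) // s.card = l },
            ‖p (k + s.1)‖₊ * a ^ s.1 * a ^ k :=
          h2.le_tsum' n
      _ = C := by
          rw [hC, Summable.tsum_sigma' (NNReal.summable_sigma.1 hsum).1 hsum]
  have hslice : iteratedDeriv n (fun s => G (s, z.2)) z.1 =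
      iteratedFDeriv ℝ n G z (fun _ => ((1 : ℝ), (0 : ℝ))) := by
    have h1 : (fun s => G (s, z.2)) =
        (fun w => G (w + (0, z.2))) ∘ ContinuousLinearMap.inl ℝ ℝ ℝ := by
      ext s
      simp
    have h2 : ContDiff ℝ ⊤ (fun w => G (w + (0, z.2))) := by fun_prop
    rw [iteratedDeriv_eq_iteratedFDeriv, h1,
      ContinuousLinearMap.iteratedFDeriv_comp_right _ h2 _ le_top,
      iteratedFDeriv_comp_add_right]
    simp
  rw [hslice, ← hq.factorial_smul, nsmul_eq_mul, abs_mul, Nat.abs_cast]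
  have h1 : |p.changeOrigin y n fun _ => ((1 : ℝ), (0 : ℝ))| ≤ ‖p.changeOrigin y n‖ := by
    refine ((p.changeOrigin y n).le_opNorm _).trans ?_
    simp
  have h2 : ‖p.changeOrigin y n‖ * (a : ℝ) ^ n ≤ C := by exact_mod_cast hcoef
  have ha0' : (0 : ℝ) < a := ha0
  have h3 : ‖p.changeOrigin y n‖ ≤ (C + 1) * ((a : ℝ)⁻¹) ^ n := by
    rw [inv_pow, ← div_eq_mul_inv, le_div_iff₀ (by positivity)]
    linarith
  calc (n.factorial : ℝ) * |p.changeOrigin y n fun _ => ((1 : ℝ), (0 : ℝ))|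
      ≤ n.factorial * ((C + 1) * ((a : ℝ)⁻¹) ^ n) := by gcongr; exact h1.trans h3
    _ = _ := by ring

/-- Cauchy estimates for partial derivatives, uniform on a compact set. -/
lemma exists_abs_iteratedDeriv_slice_le {G : ℝ × ℝ → ℝ} {K : Set (ℝ × ℝ)} (hK : IsCompact K)
    (hG : ∀ z, AnalyticAt ℝ G z) :
    ∃ C R : ℝ, 0 < C ∧ 0 < R ∧ ∀ z ∈ K, ∀ n : ℕ,
      |iteratedDeriv n (fun s => G (s, z.2)) z.1| ≤ C * n.factorial * R ^ n := by
  refine hK.induction_on (p := fun S => ∃ C R : ℝ, 0 < C ∧ 0 < R ∧ ∀ z ∈ S, ∀ n : ℕ,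
      |iteratedDeriv n (fun s => G (s, z.2)) z.1| ≤ C * n.factorial * R ^ n)
    ⟨1, 1, one_pos, one_pos, by simp⟩ ?_ ?_ ?_
  · rintro S T hST ⟨C, R, hC, hR, h⟩
    exact ⟨C, R, hC, hR, fun z hz => h z (hST hz)⟩
  · rintro S T ⟨C, R, hC, hR, h⟩ ⟨C', R', hC', hR', h'⟩
    refine ⟨max C C', max R R', lt_max_of_lt_left hC, lt_max_of_lt_left hR, ?_⟩
    rintro z (hz | hz) n
    · refine (h z hz n).trans ?_
      gcongr <;> exact le_max_left _ _
    · refine (h' z hz n).trans ?_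
      gcongr <;> exact le_max_right _ _
  · intro z hz
    obtain ⟨C, R, hC, hR, h⟩ := (hG z).eventually_abs_iteratedDeriv_slice_le
      (contDiff_iff_contDiffAt.2 fun w => (hG w).contDiffAt)
    exact ⟨_, mem_nhdsWithin_of_mem_nhds h, C, R, hC, hR, fun w hw => hw⟩

lemma integral_exp_mul_deriv {g : ℝ → ℝ} (hg : ContDiff ℝ 1 g)
    (hper : Function.Periodic g (2 * π)) (m : ℤ) :
    ∫ x in (0 : ℝ)..2 * π, Complex.exp (-(m * x * Complex.I)) * ((deriv g x : ℝ) : ℂ) =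
      (m * Complex.I) *
        ∫ x in (0 : ℝ)..2 * π, Complex.exp (-(m * x * Complex.I)) * (g x : ℂ) := by
  have hu : ∀ x : ℝ, HasDerivAt (fun x : ℝ => Complex.exp (-(m * x * Complex.I)))
      (-(m * Complex.I) * Complex.exp (-(m * x * Complex.I))) x := fun x => by
    have h : HasDerivAt (fun x : ℝ => -(m * (x : ℂ) * Complex.I)) (-(m * 1 * Complex.I)) x :=
      ((Complex.ofRealCLM.hasDerivAt.const_mul (m : ℂ)).mul_const Complex.I).neg
    exact h.cexp.congr_deriv (by ring)
  have hv : ∀ x : ℝ, HasDerivAt (fun x : ℝ => (g x : ℂ)) ((deriv g x : ℝ) : ℂ) x := fun x =>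
    (hg.differentiable one_ne_zero x).hasDerivAt.ofReal_comp
  have hg' : Continuous (deriv g) := hg.continuous_deriv le_rfl
  rw [intervalIntegral.integral_mul_deriv_eq_deriv_mul (fun x _ => hu x) (fun x _ => hv x)
    (Continuous.intervalIntegrable (by fun_prop) _ _)
    (Continuous.intervalIntegrable (by fun_prop) _ _)]
  have h2π : Complex.exp (-(m * ((2 * π : ℝ) : ℂ) * Complex.I)) = 1 := by
    rw [Complex.exp_eq_one_iff]
    exact ⟨-m, by push_cast; ring⟩
  have hg0 : g (2 * π) = g 0 := by simpa using hper 0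
  rw [h2π, hg0]
  simp only [mul_assoc, neg_mul, intervalIntegral.integral_neg,
    intervalIntegral.integral_const_mul]
  simp

lemma Function.Periodic.iteratedDeriv {g : ℝ → ℝ} {T : ℝ} (hper : Function.Periodic g T) (n : ℕ) :
    Function.Periodic (iteratedDeriv n g) T := fun x => by
  have h := congrFun (iteratedDeriv_comp_add_const n g T) x
  rw [show (fun z => g (z + T)) = g from funext hper] at h
  exact h.symm

lemma integral_exp_mul_iteratedDeriv {g : ℝ → ℝ} (hg : ContDiff ℝ ⊤ g)
    (hper : Function.Periodic g (2 * π)) (m : ℤ) (n : ℕ) :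
    ∫ x in (0 : ℝ)..2 * π, Complex.exp (-(m * x * Complex.I)) * ((iteratedDeriv n g x : ℝ) : ℂ) =
      (m * Complex.I) ^ n *
        ∫ x in (0 : ℝ)..2 * π, Complex.exp (-(m * x * Complex.I)) * (g x : ℂ) := by
  induction n with
  | zero => simp
  | succ n ih =>
    rw [pow_succ', mul_assoc, ← ih, iteratedDeriv_succ,
      integral_exp_mul_deriv _ (hper.iteratedDeriv n)]
    rw [iteratedDeriv_eq_iterate]
    exact ContDiff.iterate_deriv' 1 n (hg.of_le le_top)

/-- Factorial growth of derivatives beats a power with the right choice of the order. -/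
lemma exists_geometric_bound (R : ℝ) (hR : 0 < R) :
    ∃ q : ℝ, 0 < q ∧ q < 1 ∧ ∀ k : ℕ, ∃ n : ℕ, n.factorial * R ^ n ≤ 2 * q ^ k * (k : ℝ) ^ n := by
  refine ⟨(1 / 2 : ℝ) ^ (1 / (2 * R)), by positivity,
    rpow_lt_one (by norm_num) (by norm_num) (by positivity), fun k => ?_⟩
  refine ⟨⌊k / (2 * R)⌋₊, ?_⟩
  set n := ⌊k / (2 * R)⌋₊ with hn
  have hnle : (n : ℝ) ≤ k / (2 * R) := Nat.floor_le (by positivity)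
  have hnlt : k / (2 * R) < n + 1 := Nat.lt_floor_add_one _
  have h1 : (n.factorial : ℝ) ≤ (n : ℝ) ^ n := by exact_mod_cast Nat.factorial_le_pow n
  have h2 : (n : ℝ) * R ≤ 1 / 2 * k := by
    rw [le_div_iff₀ (by positivity)] at hnle
    linarith
  have h3 : (1 / 2 : ℝ) ^ n ≤ 2 * ((1 / 2 : ℝ) ^ (1 / (2 * R))) ^ k := by
    rw [← rpow_natCast (_ ^ _) k, ← rpow_mul (by norm_num)]
    have : (1 / 2 : ℝ) ^ ((n : ℝ) + 1) ≤ (1 / 2 : ℝ) ^ (1 / (2 * R) * k) := by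
      apply rpow_le_rpow_of_exponent_ge (by norm_num) (by norm_num)
      rw [one_div_mul_eq_div]
      exact hnlt.le
    rw [rpow_add_one (by norm_num), rpow_natCast] at this
    linarith
  calc (n.factorial : ℝ) * R ^ n ≤ (n : ℝ) ^ n * R ^ n := by gcongr
    _ = (n * R) ^ n := by rw [mul_pow]
    _ ≤ (1 / 2 * k) ^ n := by gcongr
    _ = (1 / 2) ^ n * (k : ℝ) ^ n := by rw [mul_pow]
    _ ≤ _ := by gcongr

lemma norm_integral_exp_mul_le {C R q : ℝ} (hC : 0 < C)
    (hq : ∀ k : ℕ, ∃ n : ℕ, n.factorial * R ^ n ≤ 2 * q ^ k * (k : ℝ) ^ n)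
    {g : ℝ → ℝ} (hg : ContDiff ℝ ⊤ g) (hper : Function.Periodic g (2 * π))
    (hb : ∀ s ∈ Icc 0 (2 * π), ∀ n : ℕ, |iteratedDeriv n g s| ≤ C * n.factorial * R ^ n) (m : ℤ) :
    ‖∫ x in (0 : ℝ)..2 * π, Complex.exp (-(m * x * Complex.I)) * (g x : ℂ)‖ ≤
      4 * π * C * q ^ m.natAbs := by
  have hnorm : ∀ n : ℕ, ∀ x ∈ Set.uIoc 0 (2 * π),
      ‖Complex.exp (-(m * x * Complex.I)) * ((iteratedDeriv n g x : ℝ) : ℂ)‖ ≤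
        C * n.factorial * R ^ n := fun n x hx => by
    rw [uIoc_of_le two_pi_pos.le] at hx
    have : -((m : ℂ) * x * Complex.I) = ((-(m * x) : ℝ) : ℂ) * Complex.I := by push_cast; ring
    rw [norm_mul, this, Complex.norm_exp_ofReal_mul_I, one_mul, Complex.norm_real]
    exact hb x ⟨hx.1.le, hx.2⟩ n
  have hint := fun n => intervalIntegral.norm_integral_le_of_norm_le_const (hnorm n)
  obtain ⟨n, hn⟩ := hq m.natAbs
  rcases eq_or_ne m 0 with rfl | hm
  · have := hint 0
    simp only [iteratedDeriv_zero, sub_zero, abs_of_pos two_pi_pos] at this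
    refine this.trans ?_
    simp
    nlinarith [mul_pos pi_pos hC]
  · have hmpos : 0 < (m.natAbs : ℝ) := by exact_mod_cast Int.natAbs_pos.2 hm
    have h1 := hint n
    rw [integral_exp_mul_iteratedDeriv hg hper, norm_mul, norm_pow, norm_mul, Complex.norm_I,
      mul_one, Complex.norm_intCast, ← Int.cast_abs, ← Int.natCast_natAbs, Int.cast_natCast,
      sub_zero, abs_of_pos two_pi_pos] at h1
    refine le_of_mul_le_mul_left (h1.trans ?_) (pow_pos hmpos n)
    calc C * n.factorial * R ^ n * (2 * π) = (2 * π * C) * (n.factorial * R ^ n) := by ring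
      _ ≤ (2 * π * C) * (2 * q ^ m.natAbs * (m.natAbs : ℝ) ^ n) := by gcongr
      _ = _ := by ring

lemma hasSum_cos_series {g : ℝ → ℝ} (hg : Continuous g) (hper : Function.Periodic g (2 * π))
    (heven : ∀ s, g (-s) = g s) {b : ℤ → ℂ}
    (hb : ∀ m, b m = 1 / (2 * π) *
      ∫ x in (0 : ℝ)..2 * π, Complex.exp (-(m * x * Complex.I)) * (g x : ℂ))
    (hsum : Summable b) (s : ℝ) :
    HasSum (fun m : ℤ => (b m).re * cos (m.natAbs * s)) (g s) := by
  have : Fact (0 < 2 * π) := ⟨two_pi_pos⟩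
  have hperC : Function.Periodic (fun x => (g x : ℂ)) (2 * π) := fun x => by simp [hper x]
  set F : C(AddCircle (2 * π), ℂ) := ⟨hperC.lift,
    continuous_coinduced_dom.2 (by
      show Continuous fun x => (g x : ℂ)
      fun_prop)⟩ with hF
  have hFx : ∀ x : ℝ, F (x : AddCircle (2 * π)) = g x := fun x => rfl
  have hcoef : fourierCoeff F = b := by
    funext m
    rw [fourierCoeff_eq_intervalIntegral _ _ 0, hb, zero_add, Complex.real_smul]
    congr 1
    · push_cast; rfl
    · refine intervalIntegral.integral_congr fun x _ => ?_
      simp only [fourier_coe_apply, hFx, smul_eq_mul]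
      congr 2
      have : (π : ℂ) ≠ 0 := by exact_mod_cast pi_ne_zero
      push_cast
      field_simp
  have hs : ∀ x : ℝ, HasSum (fun m : ℤ => b m * Complex.exp (m * x * Complex.I)) (g x) := by
    intro x
    have := has_pointwise_sum_fourier_series_of_summable (f := F) (by rwa [hcoef]) x
    rw [hcoef, hFx] at this
    convert! this using 2 with m
    rw [smul_eq_mul, fourier_coe_apply]
    congr 2
    have : (π : ℂ) ≠ 0 := by exact_mod_cast pi_ne_zero
    push_cast
    field_simp
  have h := Complex.hasSum_re (((hs s).add (hs (-s))).mul_left (1 / 2))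
  have hval : (1 / 2 * ((g s : ℂ) + (g (-s) : ℂ))).re = g s := by
    rw [heven, ← two_mul]; simp
  rw [hval] at h
  convert! h using 2 with m
  have hcos : cos (m.natAbs * s) = cos (m * s) := by
    rw [← cos_abs (m * s), ← cos_abs (m.natAbs * s), abs_mul, abs_mul, Nat.abs_cast,
      Nat.cast_natAbs, Int.cast_abs]
  have : 1 / 2 * (b m * Complex.exp (m * s * Complex.I) +
      b m * Complex.exp (m * ((-s : ℝ) : ℂ) * Complex.I)) = b m * ((cos (m * s) : ℝ) : ℂ) := by
    rw [Complex.ofReal_cos, Complex.cos]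
    push_cast
    ring_nf
  rw [this, Complex.re_mul_ofReal, hcos]

lemma summable_pow_natAbs {p : ℝ} (h0 : 0 ≤ p) (h1 : p < 1) :
    Summable fun m : ℤ => p ^ m.natAbs :=
  Summable.of_nat_of_neg (by simpa using summable_geometric_of_lt_one h0 h1)
    (by simpa using summable_geometric_of_lt_one h0 h1)

/-- Even periodic functions with factorially bounded derivatives are approximated by cosine
polynomials at a geometric rate depending only on the bounds. -/
lemma exists_cos_approx (C R : ℝ) (hC : 0 < C) (hR : 0 < R) :
    ∃ B p : ℝ, 0 < B ∧ 0 < p ∧ p < 1 ∧ ∀ g : ℝ → ℝ, ContDiff ℝ ⊤ g →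
      Function.Periodic g (2 * π) → (∀ s, g (-s) = g s) →
      (∀ s ∈ Icc 0 (2 * π), ∀ n : ℕ, |iteratedDeriv n g s| ≤ C * n.factorial * R ^ n) →
      ∃ b : ℤ → ℝ, ∀ (N : ℕ) (s : ℝ),
        |g s - ∑ m ∈ Finset.Ioo (-N : ℤ) N, b m * cos (m.natAbs * s)| ≤ B * p ^ N := by
  obtain ⟨q, hq0, hq1, hq⟩ := exists_geometric_bound R hR
  set p := √q with hp
  have hp0 : 0 < p := sqrt_pos.2 hq0
  have hp1 : p < 1 := by rw [hp, sqrt_lt' one_pos]; simpa using hq1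
  have hqp : q = p * p := (mul_self_sqrt hq0.le).symm
  have hsp := summable_pow_natAbs hp0.le hp1
  have htpos : 0 < ∑' m : ℤ, p ^ m.natAbs :=
    hsp.tsum_pos (fun m => by positivity) 0 (by simp)
  refine ⟨2 * C * ∑' m : ℤ, p ^ m.natAbs, p, by positivity, hp0, hp1, ?_⟩
  intro g hg hper heven hder
  set b : ℤ → ℂ := fun m => 1 / (2 * π) *
      ∫ x in (0 : ℝ)..2 * π, Complex.exp (-(m * x * Complex.I)) * (g x : ℂ) with hb
  have hbn : ∀ m, ‖b m‖ ≤ 2 * C * q ^ m.natAbs := fun m => by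
    have h := norm_integral_exp_mul_le hC hq hg hper hder m
    have h2 : ‖(1 / (2 * π) : ℂ)‖ = 1 / (2 * π) := by
      rw [norm_div, norm_mul, Complex.norm_real, norm_of_nonneg pi_pos.le]; simp
    rw [hb, norm_mul, h2, one_div_mul_eq_div, div_le_iff₀ two_pi_pos]
    linarith
  have hbs : Summable b :=
    Summable.of_norm_bounded ((summable_pow_natAbs hq0.le hq1).mul_left (2 * C)) hbn
  refine ⟨fun m => (b m).re, fun N s => ?_⟩
  have hsum := hasSum_cos_series hg.continuous hper heven (fun m => rfl) hbs s
  have hdiff := hsum.sub (hasSum_sum_of_ne_finset_zero (s := Finset.Ioo (-N : ℤ) N)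
    (f := fun m => if m ∈ Finset.Ioo (-N : ℤ) N then (b m).re * cos (m.natAbs * s) else 0)
    fun m hm => if_neg hm)
  rw [Finset.sum_congr rfl fun m hm => if_pos hm] at hdiff
  rw [← hdiff.tsum_eq, ← Real.norm_eq_abs]
  refine tsum_of_norm_bounded (g := fun m : ℤ => (2 * C * p ^ N) * p ^ m.natAbs) ?_ fun m => ?_
  · convert! hsp.hasSum.mul_left (2 * C * p ^ N) using 1
    ring
  · split_ifs with hm
    · rw [sub_self, norm_zero]
      positivity
    · have hmN : N ≤ m.natAbs := by
        rw [Finset.mem_Ioo] at hm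
        omega
      rw [sub_zero, norm_mul]
      calc ‖(b m).re‖ * ‖cos (m.natAbs * s)‖ ≤ ‖b m‖ * 1 :=
            mul_le_mul (Complex.abs_re_le_norm _) (abs_cos_le_one _) (norm_nonneg _)
              (norm_nonneg _)
        _ ≤ 2 * C * (p * p) ^ m.natAbs := by rw [mul_one, ← hqp]; exact hbn m
        _ = (2 * C * p ^ m.natAbs) * p ^ m.natAbs := by rw [mul_pow]; ring
        _ ≤ _ := by
          have := pow_le_pow_of_le_one hp0.le hp1.le hmN
          gcongr

lemma chebT_chebPt {N k : ℕ} (hN : 1 ≤ N) (hk : k ≤ N) (j : ℕ) :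
    chebT j (chebPt N k) = cos (k * (j * π / N)) := by
  have hN' : (0 : ℝ) < N := by exact_mod_cast hN
  have hk' : (k : ℝ) ≤ N := by exact_mod_cast hk
  rw [chebT, chebPt, arccos_cos (by positivity)]
  · ring_nf
  · rw [div_le_iff₀ hN', mul_comm π]
    gcongr

lemma abs_chebT_le_one (j : ℕ) (x : ℝ) : |chebT j x| ≤ 1 := abs_cos_le_one _

lemma chebPt_mem (N k : ℕ) : chebPt N k ∈ Icc (-1 : ℝ) 1 := cos_mem_Icc _

/-- The doubly-primed sum is a trapezoidal sum. -/
lemma sum_chebWeight_mul {N : ℕ} (hN : 1 ≤ N) (g : ℕ → ℝ) :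
    ∑ k ∈ Finset.range (N + 1), chebWeight N k * g k =
      ∑ k ∈ Finset.range N, (g k + g (k + 1)) / 2 := by
  obtain ⟨M, rfl⟩ : ∃ M, N = M + 1 := ⟨N - 1, by omega⟩
  rw [Finset.sum_range_succ, Finset.sum_range_succ']
  have h1 : ∀ k ∈ Finset.range M, chebWeight (M + 1) (k + 1) * g (k + 1) = g (k + 1) :=
    fun k hk => by
      have := Finset.mem_range.1 hk
      rw [chebWeight, if_neg (by omega), one_mul]
  rw [Finset.sum_congr rfl h1, ← Finset.sum_div, Finset.sum_add_distrib,
    Finset.sum_range_succ' (fun k => g k), Finset.sum_range_succ (fun k => g (k + 1))]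
  simp only [chebWeight, true_or, or_true, if_true]
  ring

lemma abs_sum_chebWeight_mul_le {N : ℕ} (hN : 1 ≤ N) {g : ℕ → ℝ} {M : ℝ}
    (hg : ∀ k ≤ N, |g k| ≤ M) :
    |∑ k ∈ Finset.range (N + 1), chebWeight N k * g k| ≤ N * M := by
  rw [sum_chebWeight_mul hN]
  refine (Finset.abs_sum_le_sum_abs _ _).trans ?_
  calc ∑ k ∈ Finset.range N, |(g k + g (k + 1)) / 2| ≤ ∑ k ∈ Finset.range N, M := by
        refine Finset.sum_le_sum fun k hk => ?_
        have hk' := Finset.mem_range.1 hk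
        have h1 := hg k hk'.le
        have h2 := hg (k + 1) hk'
        rw [abs_le] at *
        constructor <;> linarith
    _ = N * M := by simp

lemma sum_chebWeight_cos {N : ℕ} (hN : 1 ≤ N) {l : ℕ} (hl0 : 0 < l) (hl : l < 2 * N) :
    ∑ k ∈ Finset.range (N + 1), chebWeight N k * cos (k * (l * π / N)) = 0 := by
  rw [sum_chebWeight_mul hN]
  have hN' : (0 : ℝ) < N := by exact_mod_cast hN
  have hl0' : (0 : ℝ) < l := by exact_mod_cast hl0
  have hl' : (l : ℝ) < 2 * N := by exact_mod_cast hl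
  set θ : ℝ := l * π / N with hθ
  have hsin : 0 < sin (θ / 2) := by
    apply sin_pos_of_pos_of_lt_pi
    · positivity
    · rw [hθ, div_div, div_lt_iff₀ (by positivity)]
      nlinarith [pi_pos]
  refine (mul_eq_zero.1 ?_).resolve_right hsin.ne'
  rw [Finset.sum_mul]
  have h1 : ∀ k ∈ Finset.range N,
      (cos (k * θ) + cos ((k + 1 : ℕ) * θ)) / 2 * sin (θ / 2) =
        cos (θ / 2) / 2 * sin ((k + 1 : ℕ) * θ) - cos (θ / 2) / 2 * sin (k * θ) := fun k _ => by
    have e1 : (k : ℝ) * θ = (k + 1 / 2) * θ - θ / 2 := by ring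
    have e2 : ((k + 1 : ℕ) : ℝ) * θ = (k + 1 / 2) * θ + θ / 2 := by push_cast; ring
    rw [e1, e2, cos_sub, cos_add, sin_sub, sin_add]
    ring
  rw [Finset.sum_congr rfl h1, Finset.sum_range_sub (fun k : ℕ => cos (θ / 2) / 2 * sin (k * θ))]
  have : (N : ℝ) * θ = l * π := by rw [hθ]; field_simp
  rw [this, sin_nat_mul_pi]
  simp

/-- Discrete orthogonality of the Chebyshev polynomials at the Chebyshev points. -/
lemma sum_chebWeight_chebT_mul_chebT {N j m : ℕ} (hj : j < N) (hm : m < N) :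
    (2 : ℝ) ^ (if 0 < j ∧ j < N then 1 else 0) / N *
      ∑ k ∈ Finset.range (N + 1),
        chebWeight N k * (chebT m (chebPt N k) * chebT j (chebPt N k)) =
      if j = m then 1 else 0 := by
  have hN : 1 ≤ N := by omega
  have hN' : (N : ℝ) ≠ 0 := by exact_mod_cast (by omega : N ≠ 0)
  have h0 : ∑ k ∈ Finset.range (N + 1), chebWeight N k * cos (k * ((0 : ℕ) * π / N)) = N := by
    rw [sum_chebWeight_mul hN]
    simp
  have hsplit : ∀ d : ℕ, (d : ℝ) ^ 2 = ((j : ℝ) - m) ^ 2 →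
      ∑ k ∈ Finset.range (N + 1),
        chebWeight N k * (chebT m (chebPt N k) * chebT j (chebPt N k)) =
      (∑ k ∈ Finset.range (N + 1), chebWeight N k * cos (k * ((j + m : ℕ) * π / N)) +
        ∑ k ∈ Finset.range (N + 1), chebWeight N k * cos (k * (d * π / N))) / 2 := by
    intro d hd
    rw [← Finset.sum_add_distrib, Finset.sum_div]
    refine Finset.sum_congr rfl fun k hk => ?_
    have hk' : k ≤ N := by have := Finset.mem_range.1 hk; omega
    rw [chebT_chebPt hN hk', chebT_chebPt hN hk']
    have hd' : cos (k * (d * π / N)) = cos (k * (((j : ℝ) - m) * π / N)) := by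
      rcases sq_eq_sq_iff_eq_or_eq_neg.1 hd with h | h
      · rw [h]
      · rw [h, ← cos_neg]
        congr 1
        ring
    have e1 : (k : ℝ) * ((j + m : ℕ) * π / N) = k * (j * π / N) + k * (m * π / N) := by
      push_cast; ring
    have e2 : (k : ℝ) * (((j : ℝ) - m) * π / N) = k * (j * π / N) - k * (m * π / N) := by
      ring
    rw [hd', e1, e2, cos_add, cos_sub]
    ring
  rcases lt_trichotomy j m with h | rfl | h
  · rw [hsplit (m - j) (by rw [Nat.cast_sub h.le]; ring), if_neg h.ne,
      sum_chebWeight_cos hN (by omega) (by omega), sum_chebWeight_cos hN (by omega) (by omega)]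
    simp
  · rw [hsplit 0 (by simp), if_pos rfl, h0]
    rcases Nat.eq_zero_or_pos j with rfl | hj0
    · rw [add_zero, h0]
      simp [hN']
    · rw [sum_chebWeight_cos hN (by omega) (by omega), if_pos ⟨hj0, hj⟩]
      field_simp
      ring
  · rw [hsplit (j - m) (by rw [Nat.cast_sub h.le]), if_neg h.ne',
      sum_chebWeight_cos hN (by omega) (by omega), sum_chebWeight_cos hN (by omega) (by omega)]
    simp

/-- The univariate Chebyshev operator underlying `chebInterp`. -/
noncomputable def chebOp (N : ℕ) (f : ℝ → ℝ) (x : ℝ) : ℝ :=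
  ∑ j ∈ Finset.range N, ((2 : ℝ) ^ (if 0 < j ∧ j < N then 1 else 0) / N *
    ∑ k ∈ Finset.range (N + 1), chebWeight N k * (f (chebPt N k) * chebT j (chebPt N k))) *
      chebT j x

lemma chebOp_sub (N : ℕ) (f g : ℝ → ℝ) (x : ℝ) :
    chebOp N (fun t => f t - g t) x = chebOp N f x - chebOp N g x := by
  simp only [chebOp, sub_mul, mul_sub, Finset.sum_sub_distrib]

lemma chebOp_const_mul (N : ℕ) (c : ℝ) (f : ℝ → ℝ) (x : ℝ) :
    chebOp N (fun t => c * f t) x = c * chebOp N f x := by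
  simp only [chebOp, Finset.mul_sum, Finset.sum_mul]
  refine Finset.sum_congr rfl fun j _ => Finset.sum_congr rfl fun k _ => ?_
  ring

lemma chebOp_sum {ι : Type*} (N : ℕ) (s : Finset ι) (f : ι → ℝ → ℝ) (x : ℝ) :
    chebOp N (fun t => ∑ i ∈ s, f i t) x = ∑ i ∈ s, chebOp N (f i) x := by
  simp only [chebOp, Finset.sum_mul, Finset.mul_sum]
  rw [Finset.sum_comm]
  refine Eq.trans ?_ Finset.sum_comm
  rw [Finset.sum_comm]
  refine Finset.sum_congr rfl fun j _ => ?_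
  rw [Finset.sum_comm]

lemma chebOp_chebT {N m : ℕ} (hm : m < N) (x : ℝ) : chebOp N (chebT m) x = chebT m x := by
  rw [chebOp, Finset.sum_congr rfl fun j hj => by
    rw [sum_chebWeight_chebT_mul_chebT (Finset.mem_range.1 hj) hm]]
  simp [hm]

lemma abs_chebOp_le {N : ℕ} (hN : 1 ≤ N) {f : ℝ → ℝ} {M : ℝ}
    (hf : ∀ t ∈ Icc (-1 : ℝ) 1, |f t| ≤ M) (x : ℝ) : |chebOp N f x| ≤ 2 * N * M := by
  have hN' : (0 : ℝ) < N := by exact_mod_cast hN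
  have hM : 0 ≤ M := (abs_nonneg _).trans (hf 0 (by norm_num))
  refine (Finset.abs_sum_le_sum_abs _ _).trans ?_
  calc _ ≤ ∑ j ∈ Finset.range N, 2 * M := by
        refine Finset.sum_le_sum fun j _ => ?_
        rw [abs_mul, abs_mul]
        have h1 : |(2 : ℝ) ^ (if 0 < j ∧ j < N then 1 else 0) / N| ≤ 2 / N := by
          rw [abs_div, Nat.abs_cast]
          gcongr
          split_ifs <;> norm_num
        have h2 : |∑ k ∈ Finset.range (N + 1),
            chebWeight N k * (f (chebPt N k) * chebT j (chebPt N k))| ≤ N * M := by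
          refine abs_sum_chebWeight_mul_le hN fun k _ => ?_
          rw [abs_mul]
          calc _ ≤ M * 1 := mul_le_mul (hf _ (chebPt_mem N k)) (abs_chebT_le_one _ _)
                (abs_nonneg _) hM
            _ = M := mul_one M
        calc _ ≤ 2 / N * (N * M) * 1 := by
              gcongr
              exact abs_chebT_le_one _ _
          _ = 2 * M := by field_simp
    _ = _ := by simp; ring

lemma chebInterp_eq_chebOp (f : ℝ → ℝ → ℝ) (N₁ N₂ : ℕ) (c x : ℝ) :
    chebInterp f N₁ N₂ c x = chebOp N₁ (fun s => chebOp N₂ (f s) x) c := by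
  simp only [chebInterp, chebOp, chebCoeff, Finset.mul_sum, Finset.sum_mul]
  refine Finset.sum_congr rfl fun j _ => ?_
  rw [Finset.sum_comm]
  refine Finset.sum_congr rfl fun k₁ _ => ?_
  refine Finset.sum_congr rfl fun k _ => Finset.sum_congr rfl fun k₂ _ => ?_
  ring

lemma chebInterp_swap (f : ℝ → ℝ → ℝ) (N₁ N₂ : ℕ) (c x : ℝ) :
    chebInterp (fun s t => f t s) N₂ N₁ x c = chebInterp f N₁ N₂ c x := by
  unfold chebInterp chebCoeff
  rw [Finset.sum_comm]
  refine Finset.sum_congr rfl fun j _ => Finset.sum_congr rfl fun k _ => ?_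
  rw [Finset.sum_comm, mul_right_comm,
    mul_comm ((2 : ℝ) ^ (if 0 < k ∧ k < N₂ then 1 else 0) / N₂)]
  congr 3
  refine Finset.sum_congr rfl fun k₁ _ => Finset.sum_congr rfl fun k₂ _ => ?_
  ring

/-- Near-optimality of the Chebyshev operator. -/
lemma abs_sub_chebOp_le {N : ℕ} (hN : 1 ≤ N) {f : ℝ → ℝ} {b : ℤ → ℝ} {ε : ℝ}
    (hf : ∀ t ∈ Icc (-1 : ℝ) 1,
      |f t - ∑ m ∈ Finset.Ioo (-N : ℤ) N, b m * chebT m.natAbs t| ≤ ε)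
    {x : ℝ} (hx : x ∈ Icc (-1 : ℝ) 1) : |f x - chebOp N f x| ≤ (1 + 2 * N) * ε := by
  have h := abs_chebOp_le hN hf x
  have hpoly : chebOp N (fun t => ∑ m ∈ Finset.Ioo (-N : ℤ) N, b m * chebT m.natAbs t) x =
      ∑ m ∈ Finset.Ioo (-N : ℤ) N, b m * chebT m.natAbs x := by
    rw [chebOp_sum]
    refine Finset.sum_congr rfl fun m hm => ?_
    rw [Finset.mem_Ioo] at hm
    rw [chebOp_const_mul, chebOp_chebT (by omega)]
  rw [chebOp_sub, hpoly] at h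
  have h' := hf x hx
  rw [abs_le] at *
  constructor <;> linarith

lemma exists_abs_sub_chebOp_le {w : ℝ → ℝ → ℝ}
    (hw : ∀ z : ℝ × ℝ, AnalyticAt ℝ (fun z : ℝ × ℝ => w (cos z.1) (cos z.2)) z) :
    ∃ A p : ℝ, 0 < A ∧ 0 < p ∧ p < 1 ∧ ∀ N : ℕ, 1 ≤ N → ∀ c ∈ Icc (-1 : ℝ) 1,
      ∀ x ∈ Icc (-1 : ℝ) 1, |w c x - chebOp N (fun s => w s x) c| ≤ A * (1 + 2 * N) * p ^ N := by
  obtain ⟨C, R, hC, hR, hCR⟩ := exists_abs_iteratedDeriv_slice_le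
    ((isCompact_Icc (a := (0 : ℝ)) (b := 2 * π)).prod (isCompact_Icc (a := (0 : ℝ)) (b := 2 * π))) hw
  obtain ⟨B, p, hB, hp0, hp1, happrox⟩ := exists_cos_approx C R hC hR
  refine ⟨B, p, hB, hp0, hp1, fun N hN c hc x hx => ?_⟩
  have hxcos : cos (arccos x) = x := cos_arccos hx.1 hx.2
  have hxmem : arccos x ∈ Icc 0 (2 * π) :=
    ⟨arccos_nonneg x, (arccos_le_pi x).trans (by linarith [pi_pos])⟩
  have hg : ContDiff ℝ ⊤ (fun s => w (cos s) x) := by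
    have h : ContDiff ℝ ⊤ (fun z : ℝ × ℝ => w (cos z.1) (cos z.2)) :=
      contDiff_iff_contDiffAt.2 fun z => (hw z).contDiffAt
    have h' := h.comp (contDiff_id.prodMk (contDiff_const (c := arccos x)))
    simpa [Function.comp_def, hxcos] using h'
  obtain ⟨b, hb⟩ := happrox (fun s => w (cos s) x) hg (fun s => by simp) (fun s => by simp)
    (fun s hs n => by simpa [hxcos] using hCR (s, arccos x) ⟨hs, hxmem⟩ n)
  have h : |w c x - chebOp N (fun s => w s x) c| ≤ (1 + 2 * N) * (B * p ^ N) := by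
    refine abs_sub_chebOp_le hN (f := fun s => w s x) (b := b) (fun t ht => ?_) hc
    have h := hb N (arccos t)
    simpa only [cos_arccos ht.1 ht.2, chebT] using h
  exact h.trans_eq (by ring)

lemma abs_sub_chebInterp_le {w : ℝ → ℝ → ℝ} {ε₁ ε₂ : ℝ} {N₁ N₂ : ℕ} (hN₁ : 1 ≤ N₁)
    (h₁ : ∀ c ∈ Icc (-1 : ℝ) 1, ∀ x ∈ Icc (-1 : ℝ) 1,
      |w c x - chebOp N₁ (fun s => w s x) c| ≤ ε₁)
    (h₂ : ∀ c ∈ Icc (-1 : ℝ) 1, ∀ x ∈ Icc (-1 : ℝ) 1, |w c x - chebOp N₂ (w c) x| ≤ ε₂)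
    {c x : ℝ} (hc : c ∈ Icc (-1 : ℝ) 1) (hx : x ∈ Icc (-1 : ℝ) 1) :
    |w c x - chebInterp w N₁ N₂ c x| ≤ ε₁ + 2 * N₁ * ε₂ := by
  have h := abs_chebOp_le hN₁ (f := fun s => w s x - chebOp N₂ (w s) x)
    (fun s hs => h₂ s hs x hx) c
  rw [chebOp_sub] at h
  have h' := h₁ c hc x hx
  rw [chebInterp_eq_chebOp]
  rw [abs_le] at *
  constructor <;> linarith

lemma exists_sq_mul_pow_le {p : ℝ} (h0 : 0 < p) (h1 : p < 1) :
    ∃ B r : ℝ, 0 < B ∧ 0 < r ∧ r < 1 ∧ ∀ N : ℕ, (1 + 2 * (N : ℝ)) ^ 2 * p ^ N ≤ B * r ^ N := by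
  have hr0 : 0 < √p := sqrt_pos.2 h0
  have hr1 : √p < 1 := by rw [sqrt_lt' one_pos]; simpa using h1
  have hpr : p = √p * √p := (mul_self_sqrt h0.le).symm
  have habs : |√p| < 1 := by rwa [abs_of_pos hr0]
  obtain ⟨M, hM⟩ := (tendsto_pow_const_mul_const_pow_of_abs_lt_one 2 habs).bddAbove_range
  have hM' : ∀ N : ℕ, (N : ℝ) ^ 2 * √p ^ N ≤ M := fun N => hM ⟨N, rfl⟩
  have hM0 : 0 ≤ M := by simpa using hM' 0
  refine ⟨8 * M + 2, √p, by positivity, hr0, hr1, fun N => ?_⟩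
  have h2 : √p ^ N ≤ 1 := pow_le_one₀ hr0.le hr1.le
  have h3 : 0 < √p ^ N := pow_pos hr0 N
  have h4 : (1 + 2 * (N : ℝ)) ^ 2 * √p ^ N ≤ 8 * M + 2 := by
    nlinarith [hM' N, mul_nonneg (sq_nonneg (1 - 2 * (N : ℝ))) h3.le]
  calc (1 + 2 * (N : ℝ)) ^ 2 * p ^ N = ((1 + 2 * (N : ℝ)) ^ 2 * √p ^ N) * √p ^ N := by
        conv_lhs => rw [hpr, mul_pow]
        ring
    _ ≤ _ := by gcongr

lemma exists_abs_sub_chebInterp_le {w : ℝ → ℝ → ℝ}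
    (hw : ∀ z : ℝ × ℝ, AnalyticAt ℝ (fun z : ℝ × ℝ => w (cos z.1) (cos z.2)) z) :
    ∃ K r : ℝ, 0 < K ∧ 0 < r ∧ r < 1 ∧ ∀ N₁ N₂ : ℕ, 1 ≤ N₁ → 1 ≤ N₂ → ∀ c ∈ Icc (-1 : ℝ) 1,
      ∀ x ∈ Icc (-1 : ℝ) 1, |w c x - chebInterp w N₁ N₂ c x| ≤ K * (r ^ N₁ + r ^ N₂) := by
  obtain ⟨A₁, p₁, hA₁, hp₁0, hp₁1, h₁⟩ := exists_abs_sub_chebOp_le hw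
  obtain ⟨A₂, p₂, hA₂, hp₂0, hp₂1, h₂⟩ := exists_abs_sub_chebOp_le (w := fun s t => w t s)
    fun z => AnalyticAt.fun_comp (f := Prod.swap) (x := z) (hw z.swap)
      (analyticAt_snd.prod analyticAt_fst)
  set A := max A₁ A₂
  set p := max p₁ p₂
  have hA : 0 < A := lt_max_of_lt_left hA₁
  have hp0 : 0 < p := lt_max_of_lt_left hp₁0
  obtain ⟨B, r, hB, hr0, hr1, hBr⟩ := exists_sq_mul_pow_le hp0 (max_lt hp₁1 hp₂1)
  have h₁' : ∀ N : ℕ, 1 ≤ N → ∀ c ∈ Icc (-1 : ℝ) 1, ∀ x ∈ Icc (-1 : ℝ) 1,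
      |w c x - chebOp N (fun s => w s x) c| ≤ A * (1 + 2 * N) * p ^ N :=
    fun N hN c hc x hx => (h₁ N hN c hc x hx).trans (by
      gcongr
      · exact le_max_left _ _
      · exact le_max_left _ _)
  have h₂' : ∀ N : ℕ, 1 ≤ N → ∀ c ∈ Icc (-1 : ℝ) 1, ∀ x ∈ Icc (-1 : ℝ) 1,
      |w c x - chebOp N (w c) x| ≤ A * (1 + 2 * N) * p ^ N :=
    fun N hN c hc x hx => (h₂ N hN x hx c hc).trans (by
      gcongr
      · exact le_max_right _ _
      · exact le_max_right _ _)
  have key : ∀ M N : ℕ, M ≤ N → A * (1 + 2 * M) * p ^ M + 2 * M * (A * (1 + 2 * N) * p ^ N) ≤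
      A * B * (r ^ M + r ^ N) := fun M N hMN => by
    have hMN' : (M : ℝ) ≤ N := by exact_mod_cast hMN
    have hM0 : (0 : ℝ) ≤ M := M.cast_nonneg
    have e1 : A * (1 + 2 * (M : ℝ)) * p ^ M ≤ A * ((1 + 2 * M) ^ 2 * p ^ M) := by
      rw [mul_assoc]
      gcongr
      nlinarith
    have e2 : 2 * (M : ℝ) * (A * (1 + 2 * N) * p ^ N) ≤ A * ((1 + 2 * N) ^ 2 * p ^ N) := by
      calc 2 * (M : ℝ) * (A * (1 + 2 * N) * p ^ N) ≤
            (1 + 2 * N) * (A * (1 + 2 * N) * p ^ N) := by gcongr; linarith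
        _ = _ := by ring
    have e3 := mul_le_mul_of_nonneg_left (hBr M) hA.le
    have e4 := mul_le_mul_of_nonneg_left (hBr N) hA.le
    linarith
  refine ⟨A * B, r, by positivity, hr0, hr1, fun N₁ N₂ hN₁ hN₂ c hc x hx => ?_⟩
  rcases le_total N₁ N₂ with h | h
  · exact (abs_sub_chebInterp_le hN₁ (h₁' N₁ hN₁) (h₂' N₂ hN₂) hc hx).trans (key N₁ N₂ h)
  · have := abs_sub_chebInterp_le (w := fun s t => w t s) hN₂
      (fun x hx c hc => h₂' N₂ hN₂ c hc x hx) (fun x hx c hc => h₁' N₁ hN₁ c hc x hx) hx hc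
    rw [chebInterp_swap] at this
    rw [add_comm (r ^ N₁)]
    exact this.trans (key N₂ N₁ h)

lemma pow_add_pow_le_sqrt {r : ℝ} (h0 : 0 < r) (h1 : r < 1) (N₁ N₂ : ℕ) :
    r ^ N₁ + r ^ N₂ ≤ 2 * √((r⁻¹ ^ (-(2 * ((N₁ : ℝ) - 1))) + r⁻¹ ^ (-(2 * ((N₂ : ℝ) - 1)))) /
      ((1 - r⁻¹ ^ (-2 : ℝ)) * (1 - r⁻¹ ^ (-2 : ℝ)))) := by
  have hpow : ∀ N : ℕ, (r ^ N) ^ 2 ≤ r⁻¹ ^ (-(2 * ((N : ℝ) - 1))) := fun N => by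
    rw [inv_rpow h0.le, rpow_neg h0.le, inv_inv, ← pow_mul, ← rpow_natCast]
    refine rpow_le_rpow_of_exponent_ge h0 h1.le ?_
    push_cast
    linarith
  have hD : r⁻¹ ^ (-2 : ℝ) = r ^ 2 := by
    rw [inv_rpow h0.le, rpow_neg h0.le, inv_inv]
    exact_mod_cast rpow_natCast r 2
  have hr2 : 0 < r ^ 2 := by positivity
  have hr2' : r ^ 2 < 1 := pow_lt_one₀ h0.le h1 two_ne_zero
  have hD0 : 0 < (1 - r ^ 2) * (1 - r ^ 2) := mul_pos (by linarith) (by linarith)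
  have hD1 : (1 - r ^ 2) * (1 - r ^ 2) ≤ 1 := by nlinarith
  rw [hD]
  have hle : (r ^ N₁) ^ 2 + (r ^ N₂) ^ 2 ≤
      (r⁻¹ ^ (-(2 * ((N₁ : ℝ) - 1))) + r⁻¹ ^ (-(2 * ((N₂ : ℝ) - 1)))) /
        ((1 - r ^ 2) * (1 - r ^ 2)) := by
    rw [le_div_iff₀ hD0]
    refine (mul_le_of_le_one_right (by positivity) hD1).trans (add_le_add (hpow N₁) (hpow N₂))
  have e1 : r ^ N₁ ≤ √((r⁻¹ ^ (-(2 * ((N₁ : ℝ) - 1))) + r⁻¹ ^ (-(2 * ((N₂ : ℝ) - 1)))) /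
      ((1 - r ^ 2) * (1 - r ^ 2))) :=
    le_sqrt_of_sq_le (le_trans (by nlinarith [sq_nonneg (r ^ N₂)]) hle)
  have e2 : r ^ N₂ ≤ √((r⁻¹ ^ (-(2 * ((N₁ : ℝ) - 1))) + r⁻¹ ^ (-(2 * ((N₂ : ℝ) - 1)))) /
      ((1 - r ^ 2) * (1 - r ^ 2))) :=
    le_sqrt_of_sq_le (le_trans (by nlinarith [sq_nonneg (r ^ N₁)]) hle)
  linarith

/-- Subexponential error decay of the bivariate Chebyshev interpolation of the
transformed implied volatility `ṽ(c̃,x̃)`, the unique `v > 0` with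
`c(φ_x⁻¹(x̃), v) = ψ(c̃,x̃)`, where `φ_x(x) = 1 − 2(x_max − x)/(x_max − x_min)` is the
affine bijection of `[x_min, x_max]` onto `[−1,1]`, whose inverse is
`φ_x⁻¹(x̃) = x_max − (1 − x̃)(x_max − x_min)/2`, and `ψ` is real-analytic on an open set
containing `[−1,1]²` with `0 < ψ(c̃,x̃) < e^{φ_x⁻¹(x̃)/2}`. -/
theorem chebInterp_error_decay (xmin xmax : ℝ) (hxx : xmin < xmax) (hx0 : xmax ≤ 0)
    (ψ : ℝ → ℝ → ℝ)
    (hψana : ∃ U : Set (ℝ × ℝ), IsOpen U ∧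
      (Set.Icc (-1 : ℝ) 1 ×ˢ Set.Icc (-1 : ℝ) 1) ⊆ U ∧
      AnalyticOnNhd ℝ (fun p : ℝ × ℝ => ψ p.1 p.2) U)
    (hψbdd : ∀ c' ∈ Set.Icc (-1 : ℝ) 1, ∀ x' ∈ Set.Icc (-1 : ℝ) 1,
      0 < ψ c' x' ∧
        ψ c' x' < Real.exp ((xmax - (1 - x') * (xmax - xmin) / 2) / 2))
    (vt : ℝ → ℝ → ℝ)
    (hvt : ∀ c' ∈ Set.Icc (-1 : ℝ) 1, ∀ x' ∈ Set.Icc (-1 : ℝ) 1,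
      0 < vt c' x' ∧
        normCall (xmax - (1 - x') * (xmax - xmin) / 2) (vt c' x') = ψ c' x') :
    ∃ ρ₁ ρ₂ V : ℝ, 1 < ρ₁ ∧ 1 < ρ₂ ∧ 0 < V ∧
      ∀ N₁ N₂ : ℕ, 1 ≤ N₁ → 1 ≤ N₂ →
        ∀ c' ∈ Set.Icc (-1 : ℝ) 1, ∀ x' ∈ Set.Icc (-1 : ℝ) 1,
          |vt c' x' - chebInterp vt N₁ N₂ c' x'| ≤
            4 * V * Real.sqrt
              ((ρ₁ ^ (-(2 * ((N₁ : ℝ) - 1))) + ρ₂ ^ (-(2 * ((N₂ : ℝ) - 1)))) /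
                ((1 - ρ₁ ^ (-2 : ℝ)) * (1 - ρ₂ ^ (-2 : ℝ)))) := by
  obtain ⟨U, -, hSU, hψU⟩ := hψana
  have hw : ∀ z : ℝ × ℝ, AnalyticAt ℝ (fun z : ℝ × ℝ => vt (cos z.1) (cos z.2)) z := fun z => by
    have hz : (cos z.1, cos z.2) ∈ Icc (-1 : ℝ) 1 ×ˢ Icc (-1 : ℝ) 1 :=
      ⟨cos_mem_Icc _, cos_mem_Icc _⟩
    have hX : AnalyticAt ℝ (fun q : ℝ × ℝ => xmax - (1 - q.2) * (xmax - xmin) / 2)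
        (cos z.1, cos z.2) :=
      analyticAt_const.sub
        (((analyticAt_const.sub analyticAt_snd).mul analyticAt_const).div_const)
    obtain ⟨W, hW, hvW⟩ := exists_analyticAt_eq_of_normCall_eq (v := fun q => vt q.1 q.2) hz hX
      (hψU _ (hSU hz)) fun q hq => hvt q.1 hq.1 q.2 hq.2
    have hcos : AnalyticAt ℝ (fun z : ℝ × ℝ => (cos z.1, cos z.2)) z :=
      (AnalyticAt.fun_comp (f := Prod.fst) (x := z) analyticAt_cos analyticAt_fst).prod
        (AnalyticAt.fun_comp (f := Prod.snd) (x := z) analyticAt_cos analyticAt_snd)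
    refine (AnalyticAt.fun_comp (f := fun z : ℝ × ℝ => (cos z.1, cos z.2)) hW hcos).congr ?_
    filter_upwards [hcos.continuousAt.eventually hvW] with y hy
    exact (hy ⟨cos_mem_Icc _, cos_mem_Icc _⟩).symm
  obtain ⟨K, r, hK, hr0, hr1, h⟩ := exists_abs_sub_chebInterp_le hw
  refine ⟨r⁻¹, r⁻¹, K, (one_lt_inv₀ hr0).2 hr1, (one_lt_inv₀ hr0).2 hr1, hK,
    fun N₁ N₂ hN₁ hN₂ c' hc' x' hx' => (h N₁ N₂ hN₁ hN₂ c' hc' x' hx').trans ?_⟩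
  have hs := mul_le_mul_of_nonneg_left (pow_add_pow_le_sqrt hr0 hr1 N₁ N₂) hK.le
  refine hs.trans ?_
  rw [← mul_assoc]
  exact mul_le_mul_of_nonneg_right (by linarith) (sqrt_nonneg _)
end
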